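/- arXiv:2409.14819 — 9 statements merged into one kernel-verified Lean document; each statement's English description precedes it below -/
import Mathlib

section
/- Let K be a field of characteristic ≠ 2 and let f0,...,f6 ∈ K with 𝔉(x) = f6*x^6+f5*x^5+f4*x^4+f3*x^3+f2*x^2+f1*x+f0. Let x1,x2,y1,y2 ∈ K satisfy x1 ≠ x2, y1^2 = 𝔉(x1) and y2^2 = 𝔉(x2). Put k1 = 1, k2 = x1+x2, k3 = x1*x2 and k4 = (F0(x1,x2) - 2*y1*y2)/(x1-x2)^2, where F0(x1,x2) = 2*f0 + f1*(x1+x2) + 2*f2*(x1*x2) + f3*(x1*x2)*(x1+x2) + 2*f4*(x1*x2)^2 + f5*(x1*x2)^2*(x1+x2) + 2*f6*(x1*x2)^3. Then G_f(k1,k2,k3,k4) = 0, i.e. F1(k1,k2,k3)*k4^2 + F2(k1,k2,k3)*k4 + F3(k1,k2,k3) = 0. -/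
noncomputable section

/-- The General Kummer polynomial `G_f(k1,k2,k3,k4) = F1*k4^2 + F2*k4 + F3`
associated to the coefficients `f0,...,f6` of a genus-2 curve `y^2 = 𝔉(x)`. -/
def Gpoly {R : Type*} [CommRing R] (f0 f1 f2 f3 f4 f5 f6 k1 k2 k3 k4 : R) : R :=
  (k2^2 - 4*k1*k3) * k4^2
  + (-2*(2*k1^3*f0 + k1^2*k2*f1 + 2*k1^2*k3*f2 + k1*k2*k3*f3
      + 2*k1*k3^2*f4 + k2*k3^2*f5 + 2*k3^3*f6)) * k4
  + (-4*k1^4*f0*f2 + k1^4*f1^2 - 4*k1^3*k2*f0*f3 - 2*k1^3*k3*f1*f3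
     - 4*k1^2*k2^2*f0*f4 + 4*k1^2*k2*k3*f0*f5 - 4*k1^2*k2*k3*f1*f4
     - 4*k1^2*k3^2*f0*f6 + 2*k1^2*k3^2*f1*f5 - 4*k1^2*k3^2*f2*f4
     + k1^2*k3^2*f3^2 - 4*k1*k2^3*f0*f5 + 8*k1*k2^2*k3*f0*f6 - 4*k2^4*f0*f6
     - 4*k1*k2^2*k3*f1*f5 + 4*k1*k2*k3^2*f1*f6 - 4*k1*k2*k3^2*f2*f5
     - 2*k1*k3^3*f3*f5 - 4*k2^3*k3*f1*f6 - 4*k2^2*k3^2*f2*f6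
     - 4*k2*k3^3*f3*f6 - 4*k3^4*f4*f6 + k3^4*f5^2)

/-- the Kummer coordinates of a point `{(x1,y1),(x2,y2)}` of the Jacobian
of `y^2 = 𝔉(x)` satisfy the General Kummer equation. -/
theorem kummer_coords_satisfy_general_kummer
    {K : Type*} [Field K] (h2 : (2 : K) ≠ 0)
    (f0 f1 f2 f3 f4 f5 f6 x1 x2 y1 y2 : K)
    (hx : x1 ≠ x2)
    (hy1 : y1^2 = f6*x1^6 + f5*x1^5 + f4*x1^4 + f3*x1^3 + f2*x1^2 + f1*x1 + f0)
    (hy2 : y2^2 = f6*x2^6 + f5*x2^5 + f4*x2^4 + f3*x2^3 + f2*x2^2 + f1*x2 + f0) :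
    Gpoly f0 f1 f2 f3 f4 f5 f6 1 (x1 + x2) (x1 * x2)
      ((2*f0 + f1*(x1+x2) + 2*f2*(x1*x2) + f3*(x1*x2)*(x1+x2)
        + 2*f4*(x1*x2)^2 + f5*(x1*x2)^2*(x1+x2) + 2*f6*(x1*x2)^3
        - 2*y1*y2) / (x1 - x2)^2) = 0 := by
  have hD : (x1 - x2)^2 ≠ 0 := pow_ne_zero 2 (sub_ne_zero.mpr hx)
  have hyy : (y1*y2)^2 = (f6*x1^6 + f5*x1^5 + f4*x1^4 + f3*x1^3 + f2*x1^2 + f1*x1 + f0)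
      * (f6*x2^6 + f5*x2^5 + f4*x2^4 + f3*x2^3 + f2*x2^2 + f1*x2 + f0) := by
    rw [mul_pow, hy1, hy2]
  generalize hk : (2*f0 + f1*(x1+x2) + 2*f2*(x1*x2) + f3*(x1*x2)*(x1+x2)
    + 2*f4*(x1*x2)^2 + f5*(x1*x2)^2*(x1+x2) + 2*f6*(x1*x2)^3
    - 2*y1*y2) / (x1 - x2)^2 = k4
  rw [div_eq_iff hD] at hk
  refine (mul_eq_zero_iff_left hD).mp ?_
  unfold Gpoly
  linear_combination 4 * hyy + (-(x1 - x2)^2 * k4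
    + (2*f0 + f1*(x1+x2) + 2*f2*(x1*x2) + f3*(x1*x2)*(x1+x2)
      + 2*f4*(x1*x2)^2 + f5*(x1*x2)^2*(x1+x2) + 2*f6*(x1*x2)^3) + 2*y1*y2) * hk


end
end

section
/- Let K be a field of characteristic ≠ 2 and let g0,g1,g2,h0,h1,h2,h3,h4 ∈ K. Then W(g;h) * W(g;h) = Res(g,h) * I4, where Res(g,h) is the resultant of g2*x^2+g1*x+g0 and h4*x^4+h3*x^3+h2*x^2+h1*x+h0 (the determinant of the corresponding 6x6 Sylvester matrix) and I4 is the 4x4 identity matrix. In particular every eigenvalue of W(g;h) is a square root of Res(g,h). -/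
noncomputable section

/-- The matrix `W(g;h)` giving the linear action, on the General Kummer surface of
`y^2 = (g2*x^2+g1*x+g0)*(h4*x^4+h3*x^3+h2*x^2+h1*x+h0)`, of addition by the 2-torsion
class determined by this factorization. -/
def Wmat {K : Type*} [CommRing K] (g0 g1 g2 h0 h1 h2 h3 h4 : K) : Matrix (Fin 4) (Fin 4) K :=
  let w41 := -g1*g2^2*h0*h1 + g1^2*g2*h0*h2 + g0*g2^2*h1^2 - 4*g0*g2^2*h0*h2
    - g0*g1*g2*h1*h2 + g0*g1*g2*h0*h3 - g0^2*g2*h1*h3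
  let w42 := g1^2*g2*h0*h3 - g1^3*h0*h4 - 2*g0*g2^2*h0*h3 - g0*g1*g2*h1*h3
    + 4*g0*g1*g2*h0*h4 + g0*g1^2*h1*h4 - 2*g0^2*g2*h1*h4
  let w43 := -g0*g2^2*h1*h3 - g0*g1*g2*h2*h3 + g0*g1*g2*h1*h4 + g0*g1^2*h2*h4
    + g0^2*g2*h3^2 - 4*g0^2*g2*h2*h4 - g0^2*g1*h3*h4
  let w44 := -g2^2*h0 - g0*g2*h2 - g0^2*h4
  !![g2^2*h0 + g0*g2*h2 - g0^2*h4, g0*g2*h3 - g0*g1*h4, g1*g2*h3 - g1^2*h4 + 2*g0*g2*h4, g2;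
     -g0*g2*h1 - g0*g1*h2 + g0^2*h3, g2^2*h0 - g0*g2*h2 + g0^2*h4, g2^2*h1 - g1*g2*h2 - g0*g2*h3, -g1;
     -g1^2*h0 + 2*g0*g2*h0 + g0*g1*h1, -g1*g2*h0 + g0*g2*h1, -g2^2*h0 + g0*g2*h2 + g0^2*h4, g0;
     w41, w42, w43, w44]

/-- The 6×6 Sylvester matrix of the quadratic `g2*x^2+g1*x+g0` and the quartic
`h4*x^4+h3*x^3+h2*x^2+h1*x+h0`; its determinant is the resultant `Res(g,h)`. -/
def Sylv {K : Type*} [CommRing K] (g0 g1 g2 h0 h1 h2 h3 h4 : K) : Matrix (Fin 6) (Fin 6) K :=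
  !![g2, g1, g0, 0, 0, 0;
     0, g2, g1, g0, 0, 0;
     0, 0, g2, g1, g0, 0;
     0, 0, 0, g2, g1, g0;
     h4, h3, h2, h1, h0, 0;
     0, h4, h3, h2, h1, h0]

/-- The resultant of a quadratic and a quartic, expanded. -/
theorem Sylv_det {K : Type*} [CommRing K] (g0 g1 g2 h0 h1 h2 h3 h4 : K) :
    (Sylv g0 g1 g2 h0 h1 h2 h3 h4).det =
      g2^4 * h0^2 - g1 * g2^3 * h0 * h1 + g1^2 * g2^2 * h0 * h2 - g1^3 * g2 * h0 * h3
        + g1^4 * h0 * h4 + g0 * g2^3 * h1^2 - 2 * g0 * g2^3 * h0 * h2 - g0 * g1 * g2^2 * h1 * h2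
        + 3 * g0 * g1 * g2^2 * h0 * h3 + g0 * g1^2 * g2 * h1 * h3 - 4 * g0 * g1^2 * g2 * h0 * h4
        - g0 * g1^3 * h1 * h4 + g0^2 * g2^2 * h2^2 - 2 * g0^2 * g2^2 * h1 * h3
        + 2 * g0^2 * g2^2 * h0 * h4 - g0^2 * g1 * g2 * h2 * h3 + 3 * g0^2 * g1 * g2 * h1 * h4
        + g0^2 * g1^2 * h2 * h4 + g0^3 * g2 * h3^2 - 2 * g0^3 * g2 * h2 * h4
        - g0^3 * g1 * h3 * h4 + g0^4 * h4^2 := by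
  simp [Sylv, Matrix.det_succ_row_zero, Fin.sum_univ_succ, Fin.succAbove]
  ring

theorem Wmat_mul_self {K : Type*} [CommRing K] (g0 g1 g2 h0 h1 h2 h3 h4 : K) :
    Wmat g0 g1 g2 h0 h1 h2 h3 h4 * Wmat g0 g1 g2 h0 h1 h2 h3 h4
      = (Sylv g0 g1 g2 h0 h1 h2 h3 h4).det • (1 : Matrix (Fin 4) (Fin 4) K) := by
  rw [Sylv_det]
  ext i j
  fin_cases i <;> fin_cases j <;>
    simp [Wmat, Matrix.mul_apply, Fin.sum_univ_four] <;> ring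

/-- If `M * M` is the scalar `r`, then every eigenvalue of `M` squares to `r`. -/
theorem sq_eq_of_hasEigenvalue_of_mul_self_eq_smul_one {K n : Type*} [Field K] [Fintype n]
    [DecidableEq n] {M : Matrix n n K} {r μ : K} (hM : M * M = r • (1 : Matrix n n K))
    (hμ : Module.End.HasEigenvalue (Matrix.mulVecLin M : Module.End K (n → K)) μ) :
    μ ^ 2 = r := by
  obtain ⟨v, hv⟩ := hμ.exists_hasEigenvector
  have hMv : M.mulVec v = μ • v := hv.apply_eq_smul
  refine smul_left_injective K hv.2 ?_
  calc μ ^ 2 • v = M.mulVec (M.mulVec v) := by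
        rw [hMv, Matrix.mulVec_smul, hMv, smul_smul, sq]
    _ = r • v := by
        rw [Matrix.mulVec_mulVec, hM, Matrix.smul_mulVec, Matrix.one_mulVec]

/-- `W(g;h) * W(g;h) = Res(g,h) • I₄`; in particular every eigenvalue of
`W(g;h)` is a square root of the resultant `Res(g,h)`. -/
theorem Wmat_sq_eq_resultant_smul_one
    {K : Type*} [Field K] (h2 : (2 : K) ≠ 0) (g0 g1 g2 h0 h1 h2 h3 h4 : K) :
    Wmat g0 g1 g2 h0 h1 h2 h3 h4 * Wmat g0 g1 g2 h0 h1 h2 h3 h4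
      = (Sylv g0 g1 g2 h0 h1 h2 h3 h4).det • (1 : Matrix (Fin 4) (Fin 4) K) ∧
    ∀ μ : K,
      Module.End.HasEigenvalue
        (Matrix.mulVecLin (Wmat g0 g1 g2 h0 h1 h2 h3 h4) : Module.End K (Fin 4 → K)) μ →
      μ^2 = (Sylv g0 g1 g2 h0 h1 h2 h3 h4).det := by
  have hW := Wmat_mul_self g0 g1 g2 h0 h1 h2 h3 h4
  exact ⟨hW, fun _ hμ => sq_eq_of_hasEigenvalue_of_mul_self_eq_smul_one hW hμ⟩

end
end

section
/- Let K be a field of characteristic ≠ 2 and let G1 = g2*x^2+g1*x+g0, G2 = g2'*x^2+g1'*x+g0', H = h2''*x^2+h1''*x+h0'' be quadratic polynomials over K with g2 ≠ 0, g2' ≠ 0, whose four roots r1,r2 (of G1) and r3,r4 (of G2) are pairwise distinct (equivalently, disc(G1) ≠ 0, disc(G2) ≠ 0 and Res(G1,G2) ≠ 0). Let W1 = W(G1; G2*H) be the matrix built from the coefficients of G1 and of the quartic G2*H, and let W2 = W(G2; G1*H) be the matrix built from the coefficients of G2 and of the quartic G1*H. Then W1 * W2 = W2 * W1 (the matrices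 of addition by the two 2-torsion classes commute as affine matrices). -/
noncomputable section

/-- for quadratics `G1 = p2*x^2+p1*x+p0`, `G2 = q2*x^2+q1*x+q0` and
`H = r2*x^2+r1*x+r0` with the four roots of `G1*G2` pairwise distinct (i.e. both
discriminants and the resultant `Res(G1,G2)` nonzero), the matrices
`W1 = W(G1; G2*H)` and `W2 = W(G2; G1*H)` of addition by the two corresponding
2-torsion classes on the General Kummer surface of `y^2 = G1*G2*H` commute. -/
theorem Wmat_commute_of_disjoint_support
    {K : Type*} [Field K] (h2 : (2 : K) ≠ 0)
    (p0 p1 p2 q0 q1 q2 r0 r1 r2 : K)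
    (hp2 : p2 ≠ 0) (hq2 : q2 ≠ 0)
    (hdisc1 : p1^2 - 4*p0*p2 ≠ 0) (hdisc2 : q1^2 - 4*q0*q2 ≠ 0)
    (hres : (!![p2, p1, p0, 0;
                0, p2, p1, p0;
                q2, q1, q0, 0;
                0, q2, q1, q0] : Matrix (Fin 4) (Fin 4) K).det ≠ 0) :
    Wmat p0 p1 p2 (q0*r0) (q0*r1 + q1*r0) (q0*r2 + q1*r1 + q2*r0) (q1*r2 + q2*r1) (q2*r2) *
      Wmat q0 q1 q2 (p0*r0) (p0*r1 + p1*r0) (p0*r2 + p1*r1 + p2*r0) (p1*r2 + p2*r1) (p2*r2)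
    = Wmat q0 q1 q2 (p0*r0) (p0*r1 + p1*r0) (p0*r2 + p1*r1 + p2*r0) (p1*r2 + p2*r1) (p2*r2) *
      Wmat p0 p1 p2 (q0*r0) (q0*r1 + q1*r0) (q0*r2 + q1*r1 + q2*r0) (q1*r2 + q2*r1) (q2*r2) := by
  ext i j
  fin_cases i <;> fin_cases j <;>
    simp only [Wmat, Matrix.mul_apply, Fin.sum_univ_four, Fin.reduceFinMk, Fin.mk_zero,
      Fin.mk_one, Fin.isValue, Matrix.of_apply, Matrix.cons_val', Matrix.cons_val,
      Matrix.cons_val_zero, Matrix.cons_val_one, Matrix.cons_val_fin_one] <;>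
    ring

end
end

section
/- Let K be a field of characteristic ≠ 2, let r1,r2,r3 ∈ K be pairwise distinct, and let Q = q3*x^3+q2*x^2+q1*x+q0 be a cubic over K. Let W1 = W((x-r1)*(x-r2); (x-r3)*Q) be the matrix built from the coefficients of the quadratic (x-r1)*(x-r2) and the quartic (x-r3)*Q, and let W2 = W((x-r2)*(x-r3); (x-r1)*Q) be the matrix built from the coefficients of the quadratic (x-r2)*(x-r3) and the quartic (x-r1)*Q. Then W1 * W2 = - W2 * W1 (the matrices of addition by two 2-torsion classes whose supports share the common point (r2,0) anticommute). -/
noncomputable section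

set_option maxHeartbeats 4000000 in
/-- for pairwise distinct `r1,r2,r3` and a cubic `Q = q3*x^3+q2*x^2+q1*x+q0`,
the matrices `W1 = W((x-r1)*(x-r2); (x-r3)*Q)` and `W2 = W((x-r2)*(x-r3); (x-r1)*Q)`
of addition by two 2-torsion classes whose supports share the common point `(r2,0)`
anticommute: `W1 * W2 = - W2 * W1`. -/
theorem Wmat_anticommute_of_common_support
    {K : Type*} [Field K] (h2 : (2 : K) ≠ 0)
    (r1 r2 r3 q0 q1 q2 q3 : K)
    (h12 : r1 ≠ r2) (h13 : r1 ≠ r3) (h23 : r2 ≠ r3) :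
    Wmat (r1*r2) (-(r1+r2)) 1 (-(r3*q0)) (q0 - r3*q1) (q1 - r3*q2) (q2 - r3*q3) q3 *
      Wmat (r2*r3) (-(r2+r3)) 1 (-(r1*q0)) (q0 - r1*q1) (q1 - r1*q2) (q2 - r1*q3) q3
    = -(Wmat (r2*r3) (-(r2+r3)) 1 (-(r1*q0)) (q0 - r1*q1) (q1 - r1*q2) (q2 - r1*q3) q3 *
        Wmat (r1*r2) (-(r1+r2)) 1 (-(r3*q0)) (q0 - r3*q1) (q1 - r3*q2) (q2 - r3*q3) q3) := by
  ext i j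
  fin_cases i <;> fin_cases j <;>
    simp [Wmat, Matrix.mul_apply, Fin.sum_univ_four] <;> ring

end
end

section
/- (Theorem 4.1) Let K be a field of characteristic ≠ 2 and let a,b,c,d ∈ K with A = a^2+b^2+c^2+d^2, B = a^2+b^2-c^2-d^2, C = a^2-b^2+c^2-d^2, D = a^2-b^2-c^2+d^2, n1 = a*c-b*d, n2 = a*c+b*d. Assume a*b*c*d*A*B*C*D*n1*n2 ≠ 0 and (a^2*d^2-b^2*c^2)*(a^2*c^2-b^2*d^2)*(a^2*b^2-c^2*d^2) ≠ 0. Define ρ = C*D/(A*B), σ = (a*c+b*d)*C/((a*c-b*d)*A), τ = (a*c+b*d)*D/((a*c-b*d)*B), and assume 0, 1, ρ, σ, τ are pairwise distinct. Let f0,...,f6 be the coefficients of the quintic x*(x-1)*(x-ρ)*(x-σ)*(x-τ) defining the curve 𝒟 (so f6 = 0, f5 = 1). Let m1 = c^2*(a^4+b^4-c^4+d^4)-2*a^2*b^2*d^2, m2 = d^2*(a^4+b^4+c^4-d^4)-2*a^2*b^2*c^2, m3 = a^2*(a^4-b^4-c^4-d^4)+2*b^2*c^2*d^2, m4 = b^2*(a^4-b^4+c^4+d^4)-2*a^2*c^2*d^2,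 and let P be the 4x4 matrix with rows (c*n1^2*A^2*B^2, -d*n1^2*A^2*B^2, -a*n1^2*A^2*B^2, b*n1^2*A^2*B^2), (2*a*n1*A*B*m1, 2*b*n1*A*B*m2, -2*c*n1*A*B*m3, 2*d*n1*A*B*m4), (c*n1*n2*A*B*C*D, d*n1*n2*A*B*C*D, -a*n1*n2*A*B*C*D, -b*n1*n2*A*B*C*D), (2*a*n2*C*D*m1, -2*b*n2*C*D*m2, -2*c*n2*C*D*m3, -2*d*n2*C*D*m4). Then there exists a nonzero e ∈ K such that, as polynomials in X,Y,Z,T, G_f((k1,k2,k3,k4)) evaluated at (k1,k2,k3,k4)^T = P*(X,Y,Z,T)^T equals e * KFast_{a,b,c,d}(X,Y,Z,T); i.e. the map (X,Y,Z,T) ↦ P^{-1}*(k1,k2,k3,k4) is a linear map from the General Kummer surface of 𝒟 to the Fast Kummer surface. -/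
noncomputable section

open MvPolynomial

/-- `E = a*b*c*d*A*B*C*D/((a²d²-b²c²)(a²c²-b²d²)(a²b²-c²d²))`. -/
def Econst {K : Type*} [Field K] (a b c d : K) : K :=
  a*b*c*d*(a^2+b^2+c^2+d^2)*(a^2+b^2-c^2-d^2)*(a^2-b^2+c^2-d^2)*(a^2-b^2-c^2+d^2) /
    ((a^2*d^2-b^2*c^2)*(a^2*c^2-b^2*d^2)*(a^2*b^2-c^2*d^2))

/-- `F = (a⁴-b⁴-c⁴+d⁴)/(a²d²-b²c²)`. -/
def Fconst {K : Type*} [Field K] (a b c d : K) : K :=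
  (a^4-b^4-c^4+d^4)/(a^2*d^2-b^2*c^2)

/-- `G = (a⁴-b⁴+c⁴-d⁴)/(a²c²-b²d²)`. -/
def Gconst {K : Type*} [Field K] (a b c d : K) : K :=
  (a^4-b^4+c^4-d^4)/(a^2*c^2-b^2*d^2)

/-- `H = (a⁴+b⁴-c⁴-d⁴)/(a²b²-c²d²)`. -/
def Hconst {K : Type*} [Field K] (a b c d : K) : K :=
  (a^4+b^4-c^4-d^4)/(a^2*b^2-c^2*d^2)

/-- The Fast Kummer polynomial `KFast_{a,b,c,d}(X,Y,Z,T)`, with the arguments allowed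
to lie in any `K`-algebra `R`. -/
def KFast {K : Type*} [Field K] (a b c d : K)
    {R : Type*} [CommRing R] [Algebra K R] (X Y Z T : R) : R :=
  X^4 + Y^4 + Z^4 + T^4
    - algebraMap K R (Fconst a b c d) * (X^2*T^2 + Y^2*Z^2)
    - algebraMap K R (Gconst a b c d) * (X^2*Z^2 + Y^2*T^2)
    - algebraMap K R (Hconst a b c d) * (X^2*Y^2 + Z^2*T^2)
    + 2 * algebraMap K R (Econst a b c d) * (X*Y*Z*T)

/-- The Squared Kummer polynomial `KSqr_{a,b,c,d}(X,Y,Z,T)`, with the arguments allowed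
to lie in any `K`-algebra `R`. -/
def KSqr {K : Type*} [Field K] (a b c d : K)
    {R : Type*} [CommRing R] [Algebra K R] (X Y Z T : R) : R :=
  ((X^2 + Y^2 + Z^2 + T^2)
    - algebraMap K R (Fconst a b c d) * (X*T + Y*Z)
    - algebraMap K R (Gconst a b c d) * (X*Z + Y*T)
    - algebraMap K R (Hconst a b c d) * (X*Y + Z*T))^2
    - 4 * algebraMap K R (Econst a b c d)^2 * (X*Y*Z*T)

/-- If the coefficients `fᵢ` are written with denominator `s ^ 2`, then on suitably rescaled
coordinates the General Kummer polynomial is `s ^ 2 * t ^ 2` times a square minus a multiple of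
`l1 * l3`. -/
lemma Gpoly_rescale {R : Type*} [CommRing R] {s t α β ψ f1 f2 f3 f4 k1 k2 k3 k4 : R}
    (l1 l2 l3 l4 : R)
    (h1 : s^2*f1 = t^2) (h2 : s^2*f2 = -(t*α)) (h3 : s^2*f3 = ψ) (h4 : s*f4 = -β)
    (hk1 : k1 = s^2*l1) (hk2 : k2 = 2*s*l2) (hk3 : k3 = s*t*l3) (hk4 : k4 = 2*t*l4) :
    Gpoly 0 f1 f2 f3 f4 1 0 k1 k2 k3 k4 =
      s^2*t^2*((4*l2*l4 - s*t*(l1^2 + l3^2) - ψ*(l1*l3))^2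
        - 4*(s*t)*(l1*l3)*(ψ*(l1^2 + l3^2) + 4*(l2^2 + l4^2)
          - 2*α*(l1*l4 + l2*l3) - 2*β*(l1*l2 + l3*l4) + α*β*(l1*l3))) := by
  subst hk1 hk2 hk3 hk4
  unfold Gpoly
  linear_combination
    (-8*t*s^3*l4*l1^2*l2 + s^4*l1^4*(s^2*f1 + t^2) - 2*s^3*t*l1^3*l3*(s^2*f3)
      - 8*s^3*t*l1^2*l2*l3*(s*f4) + 2*s^4*t^2*l1^2*l3^2 - 16*s^3*t*l1*l2^2*l3) * h1
    + (-8*t^2*s^3*l4*l1^2*l3 - 4*s^3*t^2*l1^2*l3^2*(s*f4) - 8*s^3*t^2*l1*l2*l3^2) * h2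
    + (-8*t^2*s^2*l1*l2*l3*l4 - 2*s^3*t^3*l1^3*l3 + s^2*t^2*l1^2*l3^2*(s^2*f3 + ψ)
      - 2*s^3*t^3*l1*l3^3) * h3
    + (-8*t^3*s^3*l1*l3^2*l4 - 8*s^3*t^3*l1^2*l2*l3 + 4*s^3*t^3*α*l1^2*l3^2) * h4

/-- The quartic `w ^ 2 - 4 * s * ((c*X - a*Z) ^ 2 - (d*Y - b*T) ^ 2) * v`, for quadratic forms
`w`, `v` that split along the pairs of variables `X, Z` and `Y, T`, in terms of its coefficients. -/
lemma sq_sub_mul_eq_of_coeffs {R : Type*} [CommRing R]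
    {a b c d s w1 w2 w3 w4 w5 w6 v1 v2 v3 v4 v5 v6 e f g h k : R} (X Y Z T : R)
    (hXXXX : w1^2 - 4*s*(c^2*v1) = e)
    (hXXXZ : 2*w1*w2 - 4*s*(c^2*v2 - 2*a*c*v1) = 0)
    (hXXZZ : 2*w1*w3 + w2^2 - 4*s*(c^2*v3 - 2*a*c*v2 + a^2*v1) = g)
    (hXZZZ : 2*w2*w3 - 4*s*(a^2*v2 - 2*a*c*v3) = 0)
    (hZZZZ : w3^2 - 4*s*(a^2*v3) = e)
    (hYYYY : w4^2 + 4*s*(d^2*v4) = e)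
    (hYYYT : 2*w4*w5 + 4*s*(d^2*v5 - 2*b*d*v4) = 0)
    (hYYTT : 2*w4*w6 + w5^2 + 4*s*(d^2*v6 - 2*b*d*v5 + b^2*v4) = g)
    (hYTTT : 2*w5*w6 + 4*s*(b^2*v5 - 2*b*d*v6) = 0)
    (hTTTT : w6^2 + 4*s*(b^2*v6) = e)
    (hXXYY : 2*w1*w4 - 4*s*(c^2*v4 - d^2*v1) = h)
    (hXXYT : 2*w1*w5 - 4*s*(c^2*v5 + 2*b*d*v1) = 0)
    (hXXTT : 2*w1*w6 - 4*s*(c^2*v6 - b^2*v1) = f)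
    (hXYYZ : 2*w2*w4 - 4*s*(-2*a*c*v4 - d^2*v2) = 0)
    (hXYZT : 2*w2*w5 - 4*s*(-2*a*c*v5 + 2*b*d*v2) = k)
    (hXZTT : 2*w2*w6 - 4*s*(-2*a*c*v6 - b^2*v2) = 0)
    (hYYZZ : 2*w3*w4 - 4*s*(a^2*v4 - d^2*v3) = f)
    (hYZZT : 2*w3*w5 - 4*s*(a^2*v5 + 2*b*d*v3) = 0)
    (hZZTT : 2*w3*w6 - 4*s*(a^2*v6 - b^2*v3) = h) :
    (w1*X^2 + w2*(X*Z) + w3*Z^2 + w4*Y^2 + w5*(Y*T) + w6*T^2)^2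
        - 4*s*((c*X - a*Z)^2 - (d*Y - b*T)^2)
          * (v1*X^2 + v2*(X*Z) + v3*Z^2 + v4*Y^2 + v5*(Y*T) + v6*T^2) =
      e*(X^4 + Y^4 + Z^4 + T^4) + f*(X^2*T^2 + Y^2*Z^2) + g*(X^2*Z^2 + Y^2*T^2)
        + h*(X^2*Y^2 + Z^2*T^2) + k*(X*Y*Z*T) := by
  linear_combination X^4*hXXXX + X^3*Z*hXXXZ + X^2*Z^2*hXXZZ + X*Z^3*hXZZZ + Z^4*hZZZZ
    + Y^4*hYYYY + Y^3*T*hYYYT + Y^2*T^2*hYYTT + Y*T^3*hYTTT + T^4*hTTTT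
    + X^2*Y^2*hXXYY + X^2*Y*T*hXXYT + X^2*T^2*hXXTT
    + X*Y^2*Z*hXYYZ + X*Y*Z*T*hXYZT + X*Z*T^2*hXZTT
    + Y^2*Z^2*hYYZZ + Y*Z^2*T*hYZZT + Z^2*T^2*hZZTT

set_option maxHeartbeats 4000000 in
lemma rescaled_Gpoly_eq {R : Type*} [CommRing R]
    {a b c d A B C D n1 n2 m1 m2 m3 m4 l1 l2 l3 l4 st α β ψ : R} (X Y Z T : R)
    (hA : A = a^2+b^2+c^2+d^2) (hB : B = a^2+b^2-c^2-d^2)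
    (hC : C = a^2-b^2+c^2-d^2) (hD : D = a^2-b^2-c^2+d^2)
    (hn1 : n1 = a*c - b*d) (hn2 : n2 = a*c + b*d)
    (hm1 : m1 = c^2*(a^4+b^4-c^4+d^4) - 2*a^2*b^2*d^2)
    (hm2 : m2 = d^2*(a^4+b^4+c^4-d^4) - 2*a^2*b^2*c^2)
    (hm3 : m3 = a^2*(a^4-b^4-c^4-d^4) + 2*b^2*c^2*d^2)
    (hm4 : m4 = b^2*(a^4-b^4+c^4+d^4) - 2*a^2*c^2*d^2)
    (hst : st = n1*n2*A*B*C*D)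
    (hα : α = n1*(B*C + A*D) + n2*(A*B + C*D)) (hβ : β = n1*(A*B + C*D) + n2*(B*C + A*D))
    (hψ : ψ = n1*n2*((A^2 + C^2)*B*D + (B^2 + D^2)*A*C) + (n1^2 + n2^2)*A*B*C*D)
    (hl1 : l1 = c*X - d*Y - a*Z + b*T) (hl3 : l3 = c*X + d*Y - a*Z - b*T)
    (hl2 : l2 = a*m1*X + b*m2*Y - c*m3*Z + d*m4*T)
    (hl4 : l4 = a*m1*X - b*m2*Y - c*m3*Z - d*m4*T) :
    (4*l2*l4 - st*(l1^2 + l3^2) - ψ*(l1*l3))^2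
        - 4*st*(l1*l3)*(ψ*(l1^2 + l3^2) + 4*(l2^2 + l4^2)
          - 2*α*(l1*l4 + l2*l3) - 2*β*(l1*l2 + l3*l4) + α*β*(l1*l3)) =
      -256*(a^2*b^2-c^2*d^2)^2*(a^2*d^2-b^2*c^2)^2*
        ((a^2*d^2-b^2*c^2)*(a^2*c^2-b^2*d^2)*(a^2*b^2-c^2*d^2)*(X^4 + Y^4 + Z^4 + T^4)
          - (a^2*c^2-b^2*d^2)*(a^2*b^2-c^2*d^2)*(a^4-b^4-c^4+d^4)*(X^2*T^2 + Y^2*Z^2)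
          - (a^2*d^2-b^2*c^2)*(a^2*b^2-c^2*d^2)*(a^4-b^4+c^4-d^4)*(X^2*Z^2 + Y^2*T^2)
          - (a^2*d^2-b^2*c^2)*(a^2*c^2-b^2*d^2)*(a^4+b^4-c^4-d^4)*(X^2*Y^2 + Z^2*T^2)
          + 2*(a*b*c*d*A*B*C*D)*(X*Y*Z*T)) := by
  refine Eq.trans ?_ (Eq.trans ( sq_sub_mul_eq_of_coeffs X Y Z T (a := a) (b := b) (c := c) (d := d) (s := st)
    (w1 := 4*a^2*m1^2 - (2*st + ψ)*c^2)
    (w2 := -8*a*c*m1*m3 + 2*(2*st + ψ)*a*c)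
    (w3 := 4*c^2*m3^2 - (2*st + ψ)*a^2)
    (w4 := -4*b^2*m2^2 + (ψ - 2*st)*d^2)
    (w5 := -8*b*d*m2*m4 - 2*(ψ - 2*st)*b*d)
    (w6 := -4*d^2*m4^2 + (ψ - 2*st)*b^2)
    (v1 := (2*ψ + α*β)*c^2 + 8*a^2*m1^2 - 4*(α + β)*a*c*m1)
    (v2 := -2*(2*ψ + α*β)*a*c - 16*a*c*m1*m3 + 4*(α + β)*(c^2*m3 + a^2*m1))
    (v3 := (2*ψ + α*β)*a^2 + 8*c^2*m3^2 - 4*(α + β)*a*c*m3)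
    (v4 := (2*ψ - α*β)*d^2 + 8*b^2*m2^2 - 4*(α - β)*b*d*m2)
    (v5 := -2*(2*ψ - α*β)*b*d + 16*b*d*m2*m4 - 4*(α - β)*(d^2*m4 - b^2*m2))
    (v6 := (2*ψ - α*β)*b^2 + 8*d^2*m4^2 + 4*(α - β)*b*d*m4)
    (e := -256*(a^2*b^2-c^2*d^2)^2*(a^2*d^2-b^2*c^2)^2*
      ((a^2*d^2-b^2*c^2)*(a^2*c^2-b^2*d^2)*(a^2*b^2-c^2*d^2)))
    (f := 256*(a^2*b^2-c^2*d^2)^2*(a^2*d^2-b^2*c^2)^2*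
      ((a^2*c^2-b^2*d^2)*(a^2*b^2-c^2*d^2)*(a^4-b^4-c^4+d^4)))
    (g := 256*(a^2*b^2-c^2*d^2)^2*(a^2*d^2-b^2*c^2)^2*
      ((a^2*d^2-b^2*c^2)*(a^2*b^2-c^2*d^2)*(a^4-b^4+c^4-d^4)))
    (h := 256*(a^2*b^2-c^2*d^2)^2*(a^2*d^2-b^2*c^2)^2*
      ((a^2*d^2-b^2*c^2)*(a^2*c^2-b^2*d^2)*(a^4+b^4-c^4-d^4)))
    (k := -512*(a^2*b^2-c^2*d^2)^2*(a^2*d^2-b^2*c^2)^2*(a*b*c*d*A*B*C*D))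
    ?_ ?_ ?_ ?_ ?_ ?_ ?_ ?_ ?_ ?_ ?_ ?_ ?_ ?_ ?_ ?_ ?_ ?_ ?_) ?_)
  · rw [hl1, hl2, hl3, hl4]
    ring
  on_goal 20 => ring
  all_goals
    subst hst hα hβ hψ hA hB hC hD hn1 hn2 hm1 hm2 hm3 hm4
    ring

lemma mul_KFast {K : Type*} [Field K] {a b c d : K} {R : Type*} [CommRing R] [Algebra K R]
    (hΔ : a^2*d^2-b^2*c^2 ≠ 0) (hU : a^2*c^2-b^2*d^2 ≠ 0) (hΓ : a^2*b^2-c^2*d^2 ≠ 0)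
    (X Y Z T : R) :
    algebraMap K R ((a^2*d^2-b^2*c^2)*(a^2*c^2-b^2*d^2)*(a^2*b^2-c^2*d^2)) *
        KFast a b c d X Y Z T =
      algebraMap K R ((a^2*d^2-b^2*c^2)*(a^2*c^2-b^2*d^2)*(a^2*b^2-c^2*d^2)) *
          (X^4 + Y^4 + Z^4 + T^4)
        - algebraMap K R ((a^2*c^2-b^2*d^2)*(a^2*b^2-c^2*d^2)*(a^4-b^4-c^4+d^4)) *
          (X^2*T^2 + Y^2*Z^2)
        - algebraMap K R ((a^2*d^2-b^2*c^2)*(a^2*b^2-c^2*d^2)*(a^4-b^4+c^4-d^4)) *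
          (X^2*Z^2 + Y^2*T^2)
        - algebraMap K R ((a^2*d^2-b^2*c^2)*(a^2*c^2-b^2*d^2)*(a^4+b^4-c^4-d^4)) *
          (X^2*Y^2 + Z^2*T^2)
        + 2 * algebraMap K R (a*b*c*d*(a^2+b^2+c^2+d^2)*(a^2+b^2-c^2-d^2)*(a^2-b^2+c^2-d^2)
          *(a^2-b^2-c^2+d^2)) * (X*Y*Z*T) := by
  have hF : (a^2*c^2-b^2*d^2)*(a^2*b^2-c^2*d^2)*(a^4-b^4-c^4+d^4) =
      (a^2*d^2-b^2*c^2)*(a^2*c^2-b^2*d^2)*(a^2*b^2-c^2*d^2) * Fconst a b c d := by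
    rw [Fconst]
    linear_combination -((a^2*c^2-b^2*d^2)*(a^2*b^2-c^2*d^2)) *
      mul_div_cancel₀ (a^4-b^4-c^4+d^4) hΔ
  have hG : (a^2*d^2-b^2*c^2)*(a^2*b^2-c^2*d^2)*(a^4-b^4+c^4-d^4) =
      (a^2*d^2-b^2*c^2)*(a^2*c^2-b^2*d^2)*(a^2*b^2-c^2*d^2) * Gconst a b c d := by
    rw [Gconst]
    linear_combination -((a^2*d^2-b^2*c^2)*(a^2*b^2-c^2*d^2)) *
      mul_div_cancel₀ (a^4-b^4+c^4-d^4) hU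
  have hH : (a^2*d^2-b^2*c^2)*(a^2*c^2-b^2*d^2)*(a^4+b^4-c^4-d^4) =
      (a^2*d^2-b^2*c^2)*(a^2*c^2-b^2*d^2)*(a^2*b^2-c^2*d^2) * Hconst a b c d := by
    rw [Hconst]
    linear_combination -((a^2*d^2-b^2*c^2)*(a^2*c^2-b^2*d^2)) *
      mul_div_cancel₀ (a^4+b^4-c^4-d^4) hΓ
  have hE : a*b*c*d*(a^2+b^2+c^2+d^2)*(a^2+b^2-c^2-d^2)*(a^2-b^2+c^2-d^2)*(a^2-b^2-c^2+d^2) =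
      (a^2*d^2-b^2*c^2)*(a^2*c^2-b^2*d^2)*(a^2*b^2-c^2*d^2) * Econst a b c d := by
    rw [Econst, mul_div_cancel₀ _ (mul_ne_zero (mul_ne_zero hΔ hU) hΓ)]
  rw [hF, hG, hH, hE, KFast]
  generalize (a^2*d^2-b^2*c^2)*(a^2*c^2-b^2*d^2)*(a^2*b^2-c^2*d^2) = δ
  simp only [map_mul]
  ring

set_option maxHeartbeats 2000000 in
/-- Theorem 4.1: the map `(X,Y,Z,T) ↦ P⁻¹*(k1,k2,k3,k4)` is a linear map
from the General Kummer surface of the curve `𝒟 : y² = x(x-1)(x-ρ)(x-σ)(x-τ)` to the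
Fast Kummer surface: substituting `(k1,k2,k3,k4)ᵀ = P*(X,Y,Z,T)ᵀ` into `G_f` yields
`e * KFast_{a,b,c,d}(X,Y,Z,T)` for some `e ≠ 0`. -/
theorem fast_kummer_from_general_kummer
    {K : Type*} [Field K] (h2 : (2 : K) ≠ 0)
    (a b c d bigA bigB bigC bigD n1 n2 rho sig tau m1 m2 m3 m4 : K)
    (hA : bigA = a^2+b^2+c^2+d^2) (hB : bigB = a^2+b^2-c^2-d^2)
    (hC : bigC = a^2-b^2+c^2-d^2) (hD : bigD = a^2-b^2-c^2+d^2)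
    (hn1 : n1 = a*c - b*d) (hn2 : n2 = a*c + b*d)
    (hnz : a*b*c*d*bigA*bigB*bigC*bigD*n1*n2 ≠ 0)
    (hden : (a^2*d^2-b^2*c^2)*(a^2*c^2-b^2*d^2)*(a^2*b^2-c^2*d^2) ≠ 0)
    (hrho : rho = bigC*bigD/(bigA*bigB))
    (hsig : sig = (a*c+b*d)*bigC/((a*c-b*d)*bigA))
    (htau : tau = (a*c+b*d)*bigD/((a*c-b*d)*bigB))
    (hdist : [(0 : K), 1, rho, sig, tau].Pairwise (· ≠ ·))
    (hm1 : m1 = c^2*(a^4+b^4-c^4+d^4) - 2*a^2*b^2*d^2)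
    (hm2 : m2 = d^2*(a^4+b^4+c^4-d^4) - 2*a^2*b^2*c^2)
    (hm3 : m3 = a^2*(a^4-b^4-c^4-d^4) + 2*b^2*c^2*d^2)
    (hm4 : m4 = b^2*(a^4-b^4+c^4+d^4) - 2*a^2*c^2*d^2) :
    ∃ e : K, e ≠ 0 ∧
      Gpoly (C 0) (C (rho*sig*tau)) (C (-(rho*sig + rho*tau + sig*tau + rho*sig*tau)))
        (C (rho + sig + tau + rho*sig + rho*tau + sig*tau)) (C (-(1 + rho + sig + tau)))
        (C 1) (C 0)
        (C (c*n1^2*bigA^2*bigB^2) * (X 0 : MvPolynomial (Fin 4) K)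
          + C (-(d*n1^2*bigA^2*bigB^2)) * X 1
          + C (-(a*n1^2*bigA^2*bigB^2)) * X 2
          + C (b*n1^2*bigA^2*bigB^2) * X 3)
        (C (2*a*n1*bigA*bigB*m1) * X 0
          + C (2*b*n1*bigA*bigB*m2) * X 1
          + C (-(2*c*n1*bigA*bigB*m3)) * X 2
          + C (2*d*n1*bigA*bigB*m4) * X 3)
        (C (c*n1*n2*bigA*bigB*bigC*bigD) * X 0
          + C (d*n1*n2*bigA*bigB*bigC*bigD) * X 1
          + C (-(a*n1*n2*bigA*bigB*bigC*bigD)) * X 2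
          + C (-(b*n1*n2*bigA*bigB*bigC*bigD)) * X 3)
        (C (2*a*n2*bigC*bigD*m1) * X 0
          + C (-(2*b*n2*bigC*bigD*m2)) * X 1
          + C (-(2*c*n2*bigC*bigD*m3)) * X 2
          + C (-(2*d*n2*bigC*bigD*m4)) * X 3)
      = C e * KFast a b c d (X 0) (X 1) (X 2) (X 3) := by
  simp only [mul_ne_zero_iff, ne_eq] at hnz
  obtain ⟨⟨⟨⟨⟨⟨-, hA0⟩, hB0⟩, hC0⟩, hD0⟩, hn10⟩, hn20⟩ := hnz
  obtain ⟨hΔU, hΓ⟩ := mul_ne_zero_iff.mp hden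
  obtain ⟨hΔ, hU⟩ := mul_ne_zero_iff.mp hΔU
  rw [← hn1, ← hn2] at hsig htau
  obtain ⟨α, hα⟩ : ∃ α, α = n1*(bigB*bigC + bigA*bigD) + n2*(bigA*bigB + bigC*bigD) := ⟨_, rfl⟩
  obtain ⟨β, hβ⟩ : ∃ β, β = n1*(bigA*bigB + bigC*bigD) + n2*(bigB*bigC + bigA*bigD) := ⟨_, rfl⟩
  obtain ⟨ψ, hψ⟩ : ∃ ψ, ψ = n1*n2*((bigA^2 + bigC^2)*bigB*bigD + (bigB^2 + bigD^2)*bigA*bigC)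
    + (n1^2 + n2^2)*bigA*bigB*bigC*bigD := ⟨_, rfl⟩
  obtain ⟨s, hs⟩ : ∃ s, s = n1*bigA*bigB := ⟨_, rfl⟩
  obtain ⟨t, ht⟩ : ∃ t, t = n2*bigC*bigD := ⟨_, rfl⟩
  have h1 : s^2*(rho*sig*tau) = t^2 := by
    rw [hs, ht, hrho, hsig, htau]
    field_simp
  have h2' : s^2*(-(rho*sig + rho*tau + sig*tau + rho*sig*tau)) = -(t*α) := by
    rw [hs, ht, hα, hrho, hsig, htau]
    field_simp
    ring
  have h3 : s^2*(rho + sig + tau + rho*sig + rho*tau + sig*tau) = ψ := by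
    rw [hs, hψ, hrho, hsig, htau]
    field_simp
    ring
  have h4 : s*(-(1 + rho + sig + tau)) = -β := by
    rw [hs, hβ, hrho, hsig, htau]
    field_simp
    ring
  have h256 : (-256 : K) ≠ 0 := by
    have := neg_ne_zero.mpr (pow_ne_zero 8 h2)
    norm_num at this ⊢
    exact this
  refine ⟨-256*s^2*t^2*(a^2*b^2-c^2*d^2)^2*(a^2*d^2-b^2*c^2)^2*
      ((a^2*d^2-b^2*c^2)*(a^2*c^2-b^2*d^2)*(a^2*b^2-c^2*d^2)), ?_, ?_⟩
  · have hs0 : s ≠ 0 := hs ▸ mul_ne_zero (mul_ne_zero hn10 hA0) hB0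
    have ht0 : t ≠ 0 := ht ▸ mul_ne_zero (mul_ne_zero hn20 hC0) hD0
    exact mul_ne_zero (mul_ne_zero (mul_ne_zero (mul_ne_zero (mul_ne_zero h256
      (pow_ne_zero 2 hs0)) (pow_ne_zero 2 ht0)) (pow_ne_zero 2 hΓ)) (pow_ne_zero 2 hΔ)) hden
  have hmap {x y : K} (h : x = y) : (C x : MvPolynomial (Fin 4) K) = C y := congrArg C h
  have hst : C s * C t =
      (C n1 * C n2 * C bigA * C bigB * C bigC * C bigD : MvPolynomial (Fin 4) K) := by
    rw [hs, ht]
    simp only [map_mul]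
    ring
  have hK := mul_KFast hΔ hU hΓ (X 0 : MvPolynomial (Fin 4) K) (X 1) (X 2) (X 3)
  rw [← hA, ← hB, ← hC, ← hD, algebraMap_eq] at hK
  simp only [map_mul, map_pow, map_add, map_sub] at hK
  rw [C_0, C_1, Gpoly_rescale (s := C s) (t := C t) (α := C α) (β := C β) (ψ := C ψ)
    (C c * X 0 - C d * X 1 - C a * X 2 + C b * X 3)
    (C a * C m1 * X 0 + C b * C m2 * X 1 - C c * C m3 * X 2 + C d * C m4 * X 3)
    (C c * X 0 + C d * X 1 - C a * X 2 - C b * X 3)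
    (C a * C m1 * X 0 - C b * C m2 * X 1 - C c * C m3 * X 2 - C d * C m4 * X 3)
    (by simpa only [map_mul, map_pow] using hmap h1)
    (by simpa only [map_mul, map_pow, map_neg] using hmap h2')
    (by simpa only [map_mul, map_pow] using hmap h3)
    (by simpa only [map_mul, map_neg] using hmap h4)
    (by rw [hs]; simp only [map_mul, map_pow, map_neg]; ring)
    (by rw [hs]; simp only [map_mul, map_neg, map_ofNat]; ring)
    (by rw [hs, ht]; simp only [map_mul, map_neg]; ring)
    (by rw [ht]; simp only [map_mul, map_neg, map_ofNat]; ring),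
    rescaled_Gpoly_eq (X 0) (X 1) (X 2) (X 3)
      (by simpa only [map_add, map_pow] using hmap hA)
      (by simpa only [map_add, map_sub, map_pow] using hmap hB)
      (by simpa only [map_add, map_sub, map_pow] using hmap hC)
      (by simpa only [map_add, map_sub, map_pow] using hmap hD)
      (by simpa only [map_sub, map_mul] using hmap hn1)
      (by simpa only [map_add, map_mul] using hmap hn2)
      (by simpa only [map_add, map_sub, map_mul, map_pow, map_ofNat] using hmap hm1)
      (by simpa only [map_add, map_sub, map_mul, map_pow, map_ofNat] using hmap hm2)
      (by simpa only [map_add, map_sub, map_mul, map_pow, map_ofNat] using hmap hm3)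
      (by simpa only [map_add, map_sub, map_mul, map_pow, map_ofNat] using hmap hm4)
      hst
      (by simpa only [map_add, map_mul] using hmap hα)
      (by simpa only [map_add, map_mul] using hmap hβ)
      (by simpa only [map_add, map_mul, map_pow] using hmap hψ)
      rfl rfl rfl rfl, ← hK]
  simp only [map_mul, map_pow, map_neg, map_sub, map_ofNat]
  ring

end
end

section
/- Let K be a field of characteristic ≠ 2 and let a,b,c,d ∈ K with (a^2*d^2-b^2*c^2)*(a^2*c^2-b^2*d^2)*(a^2*b^2-c^2*d^2) ≠ 0. Then, as polynomials in X,Y,Z,T over K, KSqr_{a,b,c,d}(X^2,Y^2,Z^2,T^2) = KFast_{a,b,c,d}(X,Y,Z,T) * ( KFast_{a,b,c,d}(X,Y,Z,T) - 4*E*X*Y*Z*T ). In particular, the squaring map (X,Y,Z,T) ↦ (X^2,Y^2,Z^2,T^2) sends every point of the Fast Kummer surface KFast_{a,b,c,d} = 0 to a point of the Squared Kummer surface KSqr_{a,b,c,d} = 0. -/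
noncomputable section

open MvPolynomial

/-- The squaring identity, for arguments in an arbitrary commutative `K`-algebra. -/
theorem KSqr_sq_eq {K : Type*} [Field K] (a b c d : K)
    {R : Type*} [CommRing R] [Algebra K R] (X Y Z T : R) :
    KSqr a b c d (X^2) (Y^2) (Z^2) (T^2)
      = KFast a b c d X Y Z T *
        (KFast a b c d X Y Z T - 4 * algebraMap K R (Econst a b c d) * (X*Y*Z*T)) := by
  unfold KSqr KFast
  ring

/-- as polynomials,
`KSqr_{a,b,c,d}(X²,Y²,Z²,T²) = KFast_{a,b,c,d}(X,Y,Z,T) * (KFast_{a,b,c,d}(X,Y,Z,T) - 4*E*X*Y*Z*T)`;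
in particular the squaring map sends every point of the Fast Kummer surface to a point
of the Squared Kummer surface. -/
theorem squaring_map_fast_to_squared
    {K : Type*} [Field K] (h2 : (2 : K) ≠ 0) (a b c d : K)
    (hden : (a^2*d^2-b^2*c^2)*(a^2*c^2-b^2*d^2)*(a^2*b^2-c^2*d^2) ≠ 0) :
    (KSqr a b c d ((X 0 : MvPolynomial (Fin 4) K)^2) ((X 1)^2) ((X 2)^2) ((X 3)^2)
      = KFast a b c d (X 0) (X 1) (X 2) (X 3) *
        (KFast a b c d (X 0) (X 1) (X 2) (X 3)
          - 4 * C (Econst a b c d) * (X 0 * X 1 * X 2 * X 3))) ∧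
    ∀ x y z t : K, KFast a b c d x y z t = 0 → KSqr a b c d (x^2) (y^2) (z^2) (t^2) = 0 := by
  refine ⟨KSqr_sq_eq a b c d _ _ _ _, fun x y z t h => ?_⟩
  rw [KSqr_sq_eq, h, zero_mul]

end
end

section
/- Let K be a field of characteristic ≠ 2 and let a,b,c,d ∈ K with (a^2*d^2-b^2*c^2)*(a^2*c^2-b^2*d^2)*(a^2*b^2-c^2*d^2) ≠ 0. Set (a',b',c',d') = (a+b+c+d, a+b-c-d, a-b+c-d, a-b-c+d) and assume also (a'^2*d'^2-b'^2*c'^2)*(a'^2*c'^2-b'^2*d'^2)*(a'^2*b'^2-c'^2*d'^2) ≠ 0. Then the Hadamard map ℋ : (X,Y,Z,T) ↦ (X+Y+Z+T, X+Y-Z-T, X-Y+Z-T, X-Y-Z+T) maps the Fast Kummer surface with parameters (a,b,c,d) to the Fast Kummer surface with parameters (a',b',c',d'): for every (X,Y,Z,T) ∈ K^4 with KFast_{a,b,c,d}(X,Y,Z,T) = 0 one has KFast_{a',b',c',d'}(ℋ(X,Y,Z,T)) = 0. -/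
noncomputable section

theorem Fconst_hadamard {K : Type*} [Field K] (a b c d : K) :
    Fconst (a+b+c+d) (a+b-c-d) (a-b+c-d) (a-b-c+d) =
      ((a+b+c+d)^4 - (a+b-c-d)^4 - (a-b+c-d)^4 + (a-b-c+d)^4) /
        (8 * (a*d-b*c) * (a^2-b^2-c^2+d^2)) := by
  unfold Fconst
  congr 1
  ring

theorem Gconst_hadamard {K : Type*} [Field K] (a b c d : K) :
    Gconst (a+b+c+d) (a+b-c-d) (a-b+c-d) (a-b-c+d) =
      ((a+b+c+d)^4 - (a+b-c-d)^4 + (a-b+c-d)^4 - (a-b-c+d)^4) /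
        (8 * (a*c-b*d) * (a^2-b^2+c^2-d^2)) := by
  unfold Gconst
  congr 1
  ring

theorem Hconst_hadamard {K : Type*} [Field K] (a b c d : K) :
    Hconst (a+b+c+d) (a+b-c-d) (a-b+c-d) (a-b-c+d) =
      ((a+b+c+d)^4 + (a+b-c-d)^4 - (a-b+c-d)^4 - (a-b-c+d)^4) /
        (8 * (a*b-c*d) * (a^2+b^2-c^2-d^2)) := by
  unfold Hconst
  congr 1
  ring

theorem Econst_hadamard {K : Type*} [Field K] (h2 : (2 : K) ≠ 0) (a b c d : K) :
    Econst (a+b+c+d) (a+b-c-d) (a-b+c-d) (a-b-c+d) =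
      4 * (a+b+c+d) * (a+b-c-d) * (a-b+c-d) * (a-b-c+d) * (a^2+b^2+c^2+d^2) *
          (a*b+c*d) * (a*c+b*d) * (a*d+b*c) /
        ((a*d-b*c) * (a*c-b*d) * (a*b-c*d) *
          ((a^2+b^2-c^2-d^2) * (a^2-b^2+c^2-d^2) * (a^2-b^2-c^2+d^2))) := by
  have h512 : (512 : K) ≠ 0 := by
    rw [show (512 : K) = 2^9 by norm_num]
    exact pow_ne_zero 9 h2
  unfold Econst
  rw [← mul_div_mul_left _ ((a*d-b*c) * (a*c-b*d) * (a*b-c*d) *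
    ((a^2+b^2-c^2-d^2) * (a^2-b^2+c^2-d^2) * (a^2-b^2-c^2+d^2))) h512]
  have sA : (a+b+c+d)^2+(a+b-c-d)^2+(a-b+c-d)^2+(a-b-c+d)^2 = 4*(a^2+b^2+c^2+d^2) := by ring
  have sB : (a+b+c+d)^2+(a+b-c-d)^2-(a-b+c-d)^2-(a-b-c+d)^2 = 8*(a*b+c*d) := by ring
  have sC : (a+b+c+d)^2-(a+b-c-d)^2+(a-b+c-d)^2-(a-b-c+d)^2 = 8*(a*c+b*d) := by ring
  have sD : (a+b+c+d)^2-(a+b-c-d)^2-(a-b+c-d)^2+(a-b-c+d)^2 = 8*(a*d+b*c) := by ring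
  have dF : (a+b+c+d)^2*(a-b-c+d)^2 - (a+b-c-d)^2*(a-b+c-d)^2 =
      8*((a*d-b*c)*(a^2-b^2-c^2+d^2)) := by ring
  have dG : (a+b+c+d)^2*(a-b+c-d)^2 - (a+b-c-d)^2*(a-b-c+d)^2 =
      8*((a*c-b*d)*(a^2-b^2+c^2-d^2)) := by ring
  have dH : (a+b+c+d)^2*(a+b-c-d)^2 - (a-b+c-d)^2*(a-b-c+d)^2 =
      8*((a*b-c*d)*(a^2+b^2-c^2-d^2)) := by ring
  rw [sA, sB, sC, sD, dF, dG, dH]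
  generalize a+b+c+d = p
  generalize a+b-c-d = q
  generalize a-b+c-d = r
  generalize a-b-c+d = s
  congr 1 <;> ring

/-- the Hadamard map `ℋ` maps the Fast Kummer surface with parameters
`(a,b,c,d)` to the Fast Kummer surface with parameters
`(a',b',c',d') = ℋ(a,b,c,d)`. -/
theorem hadamard_map_fast_kummer
    {K : Type*} [Field K] (h2 : (2 : K) ≠ 0) (a b c d : K)
    (hden : (a^2*d^2-b^2*c^2)*(a^2*c^2-b^2*d^2)*(a^2*b^2-c^2*d^2) ≠ 0)
    (hden' : ((a+b+c+d)^2*(a-b-c+d)^2 - (a+b-c-d)^2*(a-b+c-d)^2) *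
             ((a+b+c+d)^2*(a-b+c-d)^2 - (a+b-c-d)^2*(a-b-c+d)^2) *
             ((a+b+c+d)^2*(a+b-c-d)^2 - (a-b+c-d)^2*(a-b-c+d)^2) ≠ 0) :
    ∀ X Y Z T : K, KFast a b c d X Y Z T = 0 →
      KFast (a+b+c+d) (a+b-c-d) (a-b+c-d) (a-b-c+d)
        (X+Y+Z+T) (X+Y-Z-T) (X-Y+Z-T) (X-Y-Z+T) = 0 := by
  intro X Y Z T hK
  have h8 : (8 : K) ≠ 0 := by
    rw [show (8 : K) = 2^3 by norm_num]
    exact pow_ne_zero 3 h2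
  have factored : (a*d-b*c)*(a*d+b*c)*((a*c-b*d)*(a*c+b*d))*((a*b-c*d)*(a*b+c*d)) ≠ 0 := by
    convert hden using 1
    ring
  have factored' : (8*(a*d-b*c)*(a^2-b^2-c^2+d^2))*(8*(a*c-b*d)*(a^2-b^2+c^2-d^2))*
      (8*(a*b-c*d)*(a^2+b^2-c^2-d^2)) ≠ 0 := by
    convert hden' using 1
    congr 1
    · congr 1 <;> ring
    · ring
  simp only [mul_ne_zero_iff] at factored factored'
  obtain ⟨⟨⟨hu, hu'⟩, hv, hv'⟩, hw, hw'⟩ := factored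
  obtain ⟨⟨⟨-, hD⟩, -, hC⟩, -, hB⟩ := factored'
  have hF : Fconst a b c d = (a^4-b^4-c^4+d^4) / ((a*d-b*c)*(a*d+b*c)) := by
    unfold Fconst; congr 1; ring
  have hG : Gconst a b c d = (a^4-b^4+c^4-d^4) / ((a*c-b*d)*(a*c+b*d)) := by
    unfold Gconst; congr 1; ring
  have hH : Hconst a b c d = (a^4+b^4-c^4-d^4) / ((a*b-c*d)*(a*b+c*d)) := by
    unfold Hconst; congr 1; ring
  have hE : Econst a b c d =
      a*b*c*d*(a^2+b^2+c^2+d^2)*(a^2+b^2-c^2-d^2)*(a^2-b^2+c^2-d^2)*(a^2-b^2-c^2+d^2) /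
        ((a*d-b*c)*(a*d+b*c)*((a*c-b*d)*(a*c+b*d))*((a*b-c*d)*(a*b+c*d))) := by
    unfold Econst; congr 1; ring
  have hF' := Fconst_hadamard a b c d
  have hG' := Gconst_hadamard a b c d
  have hH' := Hconst_hadamard a b c d
  have hE' := Econst_hadamard h2 a b c d
  obtain ⟨l, hl⟩ : ∃ l, l = 128 * ((a*d+b*c)*(a*c+b*d)*(a*b+c*d)) /
      ((a^2+b^2-c^2-d^2)*(a^2-b^2+c^2-d^2)*(a^2-b^2-c^2+d^2)) := ⟨_, rfl⟩
  simp only [KFast, Algebra.algebraMap_self, RingHom.id_apply] at hK ⊢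
  generalize Fconst (a+b+c+d) (a+b-c-d) (a-b+c-d) (a-b-c+d) = F' at *
  generalize Gconst (a+b+c+d) (a+b-c-d) (a-b+c-d) (a-b-c+d) = G' at *
  generalize Hconst (a+b+c+d) (a+b-c-d) (a-b+c-d) (a-b-c+d) = H' at *
  generalize Econst (a+b+c+d) (a+b-c-d) (a-b+c-d) (a-b-c+d) = E' at *
  generalize Fconst a b c d = F at *
  generalize Gconst a b c d = G at *
  generalize Hconst a b c d = H at *
  generalize Econst a b c d = E at *
  have coeff_pow : 4 - 2*F' - 2*G' - 2*H' + 2*E' = l := by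
    rw [hF', hG', hH', hE', hl]
    field_simp
    ring
  have coeff_F : 24 - 12*F' + 4*G' + 4*H' - 4*E' = -(l*F) := by
    rw [hF', hG', hH', hE', hl, hF]
    field_simp
    ring
  have coeff_G : 24 + 4*F' - 12*G' + 4*H' - 4*E' = -(l*G) := by
    rw [hF', hG', hH', hE', hl, hG]
    field_simp
    ring
  have coeff_H : 24 + 4*F' + 4*G' - 12*H' - 4*E' = -(l*H) := by
    rw [hF', hG', hH', hE', hl, hH]
    field_simp
    ring
  have coeff_E : 96 + 16*F' + 16*G' + 16*H' + 16*E' = 2*l*E := by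
    rw [hF', hG', hH', hE', hl, hE]
    field_simp
    ring
  linear_combination l * hK + (X^4 + Y^4 + Z^4 + T^4) * coeff_pow
    + (X^2*T^2 + Y^2*Z^2) * coeff_F + (X^2*Z^2 + Y^2*T^2) * coeff_G
    + (X^2*Y^2 + Z^2*T^2) * coeff_H + X*Y*Z*T * coeff_E

end
end

section
/- (Lemma 5.1, translation invariance) Let M be an additive commutative group, K a commutative ring, and k1,k2,k3,k4 : M → K. Let N = 2n+1 with n ≥ 1 and let R ∈ M satisfy N•R = 0. For ℓ ∈ {1,...,n} and i,j ∈ {1,2,3,4} define Bℓ_{i,j} : M → K by Bℓ_{i,j}(P) = k_i(P + ℓ•R)*k_j(P - ℓ•R) + k_j(P + ℓ•R)*k_i(P - ℓ•R). For any tuple I = (i_1,...,i_N) ∈ {1,2,3,4}^N define F_I : M → K by F_I(P) = Σ_{σ ∈ Sym({1,...,N})} k_{i_{σ(1)}}(P) * B1_{i_{σ(2)}, i_{σ(3)}}(P) * B2_{i_{σ(4)}, i_{σ(5)}}(P) * ... * Bn_{i_{σ(N-1)}, i_{σ(N)}}(P), the sum taken over all permutations σ of {1,...,N}. Then F_I(P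 + R) = F_I(P) for every P ∈ M. -/
/-- The multiple of `R` placed at position `j`: `0` at position `0`, and `±(m + 1)` at the
positions `2 * m + 1` and `2 * m + 2`, in the order prescribed by `b m`. -/
def signedOffset (b : ℕ → Bool) (j : ℕ) : ℤ :=
  if (j % 2 = 1 ↔ b ((j - 1) / 2) = true) then ((j + 1) / 2 : ℕ) else -((j + 1) / 2 : ℕ)

lemma signedOffset_zero (b : ℕ → Bool) : signedOffset b 0 = 0 := by
  simp [signedOffset]

lemma signedOffset_odd (b : ℕ → Bool) (m : ℕ) :
    signedOffset b (2 * m + 1) = if b m then ((m + 1 : ℕ) : ℤ) else -((m + 1 : ℕ) : ℤ) := by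
  have h1 : (2 * m + 1) % 2 = 1 := by omega
  have h2 : (2 * m + 1 - 1) / 2 = m := by omega
  have h3 : (2 * m + 1 + 1) / 2 = m + 1 := by omega
  simp only [signedOffset, h1, h2, h3, true_iff]

lemma signedOffset_even (b : ℕ → Bool) (m : ℕ) :
    signedOffset b (2 * m + 2) = if b m then -((m + 1 : ℕ) : ℤ) else ((m + 1 : ℕ) : ℤ) := by
  have h1 : ¬ (2 * m + 2) % 2 = 1 := by omega
  have h2 : (2 * m + 2 - 1) / 2 = m := by omega
  have h3 : (2 * m + 2 + 1) / 2 = m + 1 := by omega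
  simp only [signedOffset, h1, h2, h3, false_iff]
  cases b m <;> simp

lemma natAbs_signedOffset (b : ℕ → Bool) (j : ℕ) :
    (signedOffset b j).natAbs = (j + 1) / 2 := by
  unfold signedOffset
  split_ifs <;> omega

lemma signedOffset_injective (b : ℕ → Bool) : Function.Injective (signedOffset b) := by
  intro i j h
  have habs : (i + 1) / 2 = (j + 1) / 2 := by
    rw [← natAbs_signedOffset b i, ← natAbs_signedOffset b j, h]
  have hm : (i - 1) / 2 = (j - 1) / 2 := by omega
  unfold signedOffset at h
  rw [habs, hm] at h
  split_ifs at h with h1 h2 h2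
  · have : i % 2 = 1 ↔ j % 2 = 1 := h1.trans h2.symm
    omega
  · omega
  · omega
  · have : i % 2 = 1 ↔ j % 2 = 1 := by tauto
    omega

lemma signedOffset_zmod_bijective (b : ℕ → Bool) (n : ℕ) :
    Function.Bijective
      (fun j : Fin (2 * n + 1) => ((signedOffset b j : ℤ) : ZMod (2 * n + 1))) := by
  rw [Fintype.bijective_iff_injective_and_card]
  refine ⟨fun i j h => ?_, by simp⟩
  have hdvd := (ZMod.intCast_eq_intCast_iff_dvd_sub _ _ _).1 h
  have hi := natAbs_signedOffset b i
  have hj := natAbs_signedOffset b j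
  have hzero : signedOffset b j - signedOffset b i = 0 := by
    apply Int.eq_zero_of_abs_lt_dvd hdvd
    have := i.isLt
    have := j.isLt
    rw [abs_lt]
    omega
  exact Fin.ext (signedOffset_injective b (by omega))

lemma exists_perm_signedOffset_zsmul {M : Type*} [AddCommGroup M] (b : ℕ → Bool) (n : ℕ)
    (R : M) (hR : (2 * n + 1) • R = 0) :
    ∃ π : Equiv.Perm (Fin (2 * n + 1)),
      ∀ j, signedOffset b (π j) • R = (signedOffset b j + 1) • R := by
  let c := Equiv.ofBijective _ (signedOffset_zmod_bijective b n)
  refine ⟨(c.trans (Equiv.addRight 1)).trans c.symm, fun j => ?_⟩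
  have h : c (((c.trans (Equiv.addRight 1)).trans c.symm) j) = c j + 1 := by simp
  generalize ((c.trans (Equiv.addRight 1)).trans c.symm) j = i at h ⊢
  have h' : ((signedOffset b i : ℤ) : ZMod (2 * n + 1)) =
      ((signedOffset b j + 1 : ℤ) : ZMod (2 * n + 1)) := by
    rw [Int.cast_add, Int.cast_one]
    exact h
  obtain ⟨d, hd⟩ := (ZMod.intCast_eq_intCast_iff_dvd_sub _ _ _).1 h'
  rw [← sub_eq_zero, ← neg_eq_zero, neg_sub, ← sub_smul, hd, mul_comm, mul_smul, natCast_zsmul,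
    hR, smul_zero]

lemma Fin.prod_univ_two_mul_add_one {K : Type*} [CommMonoid K] (n : ℕ)
    (f : Fin (2 * n + 1) → K) :
    ∏ j, f j = f ⟨0, by omega⟩ *
      ∏ m : Fin n, (f ⟨2 * m.1 + 1, by omega⟩ * f ⟨2 * m.1 + 2, by omega⟩) := by
  induction n with
  | zero => simp
  | succ n ih =>
    have h := Fin.prod_univ_castSucc (n := 2 * n + 1 + 1) f
    rw [Fin.prod_univ_castSucc (n := 2 * n + 1), ih] at h
    rw [Fin.prod_univ_castSucc (n := n), ← mul_assoc]
    exact h.trans (mul_assoc _ _ _ |>.trans rfl)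

/-- Reindexing the symmetrized product by a permutation of the evaluation points. -/
lemma sum_perm_prod_comp {ι α M K : Type*} [Fintype ι] [DecidableEq ι] [CommRing K]
    (k : α → M → K) (I : ι → α) (g : ι → M) (π : Equiv.Perm ι) :
    ∑ σ : Equiv.Perm ι, ∏ j, k (I (σ j)) (g (π j)) =
      ∑ σ : Equiv.Perm ι, ∏ j, k (I (σ j)) (g j) := by
  rw [← Equiv.sum_comp (Equiv.mulRight π)]
  refine Finset.sum_congr rfl fun σ _ => ?_
  exact Equiv.prod_comp π fun j => k (I (σ j)) (g j)

/-- Extend a finite family of orientations to `ℕ`. -/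
def extendBool {n : ℕ} (s : Fin n → Bool) (m : ℕ) : Bool :=
  if h : m < n then s ⟨m, h⟩ else false

lemma extendBool_val {n : ℕ} (s : Fin n → Bool) (m : Fin n) : extendBool s m = s m := by
  simp [extendBool]

lemma mul_prod_add_eq_sum_prod_signedOffset {α M K : Type*} [AddCommGroup M] [CommRing K]
    (k : α → M → K) (n : ℕ) (R P : M) (J : Fin (2 * n + 1) → α) :
    k (J ⟨0, by omega⟩) P * ∏ m : Fin n,
      (k (J ⟨2 * m.1 + 1, by omega⟩) (P + (m.1 + 1) • R) *
          k (J ⟨2 * m.1 + 2, by omega⟩) (P - (m.1 + 1) • R) +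
        k (J ⟨2 * m.1 + 2, by omega⟩) (P + (m.1 + 1) • R) *
          k (J ⟨2 * m.1 + 1, by omega⟩) (P - (m.1 + 1) • R)) =
    ∑ s : Fin n → Bool, ∏ j, k (J j) (P + signedOffset (extendBool s) j • R) := by
  simp_rw [Fin.prod_univ_two_mul_add_one, signedOffset_zero, signedOffset_odd, signedOffset_even,
    extendBool_val, zero_smul, add_zero, ← Finset.mul_sum]
  congr 1
  have h := Finset.prod_univ_sum (fun _ : Fin n => (Finset.univ : Finset Bool))
    (fun m b => k (J ⟨2 * m.1 + 1, by omega⟩)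
        (P + (if b then ((m.1 + 1 : ℕ) : ℤ) else -((m.1 + 1 : ℕ) : ℤ)) • R) *
      k (J ⟨2 * m.1 + 2, by omega⟩)
        (P + (if b then -((m.1 + 1 : ℕ) : ℤ) else ((m.1 + 1 : ℕ) : ℤ)) • R))
  rw [Fintype.piFinset_univ] at h
  rw [← h]
  refine Finset.prod_congr rfl fun m _ => ?_
  rw [Fintype.sum_bool]
  simp only [if_true, Bool.false_eq_true, if_false, neg_smul, natCast_zsmul, ← sub_eq_add_neg]
  ring

/-- Lemma 5.1, translation invariance: for an `N`-torsion point `R`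
(`N = 2n+1` odd) in an additive commutative group `M`, coordinate functions
`k i : M → K`, and the "biquadratic" combinations
`Bℓ_{i,j}(P) = k_i(P+ℓ•R)*k_j(P-ℓ•R) + k_j(P+ℓ•R)*k_i(P-ℓ•R)`, the symmetrized
degree-`N` forms
`F_I(P) = Σ_{σ ∈ Sym(N)} k_{i_{σ(1)}}(P) * B1_{i_{σ(2)},i_{σ(3)}}(P) * ⋯ * Bn_{i_{σ(N-1)},i_{σ(N)}}(P)`
are invariant under translation by `R`. -/
theorem forms_invariant_under_translation
    {M K : Type*} [AddCommGroup M] [CommRing K]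
    (k : Fin 4 → M → K) (n : ℕ) (hn : 1 ≤ n)
    (R : M) (hR : (2*n+1) • R = 0)
    (I : Fin (2*n+1) → Fin 4)
    (B : ℕ → Fin 4 → Fin 4 → M → K)
    (hB : ∀ (ℓ : ℕ) (i j : Fin 4) (P : M),
      B ℓ i j P = k i (P + ℓ • R) * k j (P - ℓ • R) + k j (P + ℓ • R) * k i (P - ℓ • R))
    (F : M → K)
    (hF : ∀ P : M, F P = ∑ σ : Equiv.Perm (Fin (2*n+1)),
      k (I (σ ⟨0, by omega⟩)) P *
        ∏ m : Fin n,
          B (m.1 + 1)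
            (I (σ ⟨2*m.1 + 1, by have := m.isLt; omega⟩))
            (I (σ ⟨2*m.1 + 2, by have := m.isLt; omega⟩)) P)
    (P : M) :
    F (P + R) = F P := by
  have key : ∀ Q : M, F Q = ∑ s : Fin n → Bool, ∑ σ : Equiv.Perm (Fin (2 * n + 1)),
      ∏ j, k (I (σ j)) (Q + signedOffset (extendBool s) j • R) := by
    intro Q
    rw [hF, Finset.sum_comm]
    refine Finset.sum_congr rfl fun σ _ => ?_
    simp only [hB]
    exact mul_prod_add_eq_sum_prod_signedOffset k n R Q fun j => I (σ j)
  rw [key, key]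
  refine Finset.sum_congr rfl fun s _ => ?_
  obtain ⟨π, hπ⟩ := exists_perm_signedOffset_zsmul (extendBool s) n R hR
  rw [← sum_perm_prod_comp k I (fun j => P + signedOffset (extendBool s) j • R) π]
  simp only [hπ, add_smul, one_smul, add_assoc, add_comm R]
end

section
/- Let K be an algebraically closed field of characteristic ≠ 2 and let a,b,c,d ∈ K satisfy: a*b*c*d*A*B*C*D ≠ 0, (a^2*d^2-b^2*c^2)*(a^2*c^2-b^2*d^2)*(a^2*b^2-c^2*d^2) ≠ 0, (A*B-C*D)*(A*C-B*D)*(A*D-B*C) ≠ 0, a*c-b*d ≠ 0, and the elements 0, 1, ρ = C*D/(A*B), σ = (a*c+b*d)*C/((a*c-b*d)*A), τ = (a*c+b*d)*D/((a*c-b*d)*B) are pairwise distinct. Let v0 = (a,b,c,d). Then for every nonzero w = (w1,w2,w3,w4) ∈ K^4 with KFast_{a,b,c,d}(w) = 0 and all i,j,k,l ∈ {1,2,3,4}: B_{ij}(w, v0) * w_k * w_l = B_{kl}(w, v0) * w_i * w_j; i.e. the matrix (B_{ij}(w, (a,b,c,d)))_{ij} is projectively equal to the matrix (w_i * w_j)_{ij}.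 (This is the case Q = identity of the biquadratic-form identity on the Fast Kummer surface.) -/
noncomputable section

/-- The symmetric 4×4 matrix of biquadratic forms `B_{ij}(u,v)` on the Fast Kummer
surface with parameters `(a,b,c,d)`. -/
def BB {K : Type*} [Field K] (a b c d : K) (u v : Fin 4 → K) : Matrix (Fin 4) (Fin 4) K :=
  let A := a^2+b^2+c^2+d^2
  let B := a^2+b^2-c^2-d^2
  let Cc := a^2-b^2+c^2-d^2
  let D := a^2-b^2-c^2+d^2
  let sA := (u 0^2+u 1^2+u 2^2+u 3^2)*(v 0^2+v 1^2+v 2^2+v 3^2)/(4*A)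
  let sB := (u 0^2+u 1^2-u 2^2-u 3^2)*(v 0^2+v 1^2-v 2^2-v 3^2)/(4*B)
  let sC := (u 0^2-u 1^2+u 2^2-u 3^2)*(v 0^2-v 1^2+v 2^2-v 3^2)/(4*Cc)
  let sD := (u 0^2-u 1^2-u 2^2+u 3^2)*(v 0^2-v 1^2-v 2^2+v 3^2)/(4*D)
  let B12 := 4*(a*b*(u 0*u 1*v 0*v 1 + u 2*u 3*v 2*v 3)
    - c*d*(u 0*u 1*v 2*v 3 + u 2*u 3*v 0*v 1))/(A*B - Cc*D)
  let B13 := 4*(a*c*(u 0*u 2*v 0*v 2 + u 1*u 3*v 1*v 3)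
    - b*d*(u 0*u 2*v 1*v 3 + u 1*u 3*v 0*v 2))/(A*Cc - B*D)
  let B14 := 4*(a*d*(u 0*u 3*v 0*v 3 + u 1*u 2*v 1*v 2)
    - b*c*(u 0*u 3*v 1*v 2 + u 1*u 2*v 0*v 3))/(A*D - B*Cc)
  let B23 := 4*(b*c*(u 0*u 3*v 0*v 3 + u 1*u 2*v 1*v 2)
    - a*d*(u 0*u 3*v 1*v 2 + u 1*u 2*v 0*v 3))/(B*Cc - A*D)
  let B24 := 4*(b*d*(u 0*u 2*v 0*v 2 + u 1*u 3*v 1*v 3)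
    - a*c*(u 0*u 2*v 1*v 3 + u 1*u 3*v 0*v 2))/(B*D - A*Cc)
  let B34 := 4*(c*d*(u 0*u 1*v 0*v 1 + u 2*u 3*v 2*v 3)
    - a*b*(u 2*u 3*v 0*v 1 + u 0*u 1*v 2*v 3))/(Cc*D - A*B)
  !![sA+sB+sC+sD, B12, B13, B14;
     B12, sA+sB-sC-sD, B23, B24;
     B13, B23, sA-sB+sC-sD, B34;
     B14, B24, B34, sA-sB-sC+sD]

/-- At the identity `(a, b, c, d)`, the biquadratic forms are exactly the products `w i * w j`. -/
theorem BB_at_identity {K : Type*} [Field K] (h2 : (2 : K) ≠ 0) (a b c d : K)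
    (hA : a^2+b^2+c^2+d^2 ≠ 0) (hB : a^2+b^2-c^2-d^2 ≠ 0)
    (hC : a^2-b^2+c^2-d^2 ≠ 0) (hD : a^2-b^2-c^2+d^2 ≠ 0)
    (hAD : a^2*d^2-b^2*c^2 ≠ 0) (hAC : a^2*c^2-b^2*d^2 ≠ 0) (hAB : a^2*b^2-c^2*d^2 ≠ 0)
    (w : Fin 4 → K) (i j : Fin 4) :
    BB a b c d w ![a, b, c, d] i j = w i * w j := by
  have h4 : (4 : K) ≠ 0 := by
    have h : (4 : K) = 2 * 2 := by norm_num
    rw [h]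
    exact mul_ne_zero h2 h2
  have eAB : (a^2+b^2+c^2+d^2)*(a^2+b^2-c^2-d^2) - (a^2-b^2+c^2-d^2)*(a^2-b^2-c^2+d^2)
      = 4*(a^2*b^2-c^2*d^2) := by ring
  have eCD : (a^2-b^2+c^2-d^2)*(a^2-b^2-c^2+d^2) - (a^2+b^2+c^2+d^2)*(a^2+b^2-c^2-d^2)
      = -(4*(a^2*b^2-c^2*d^2)) := by ring
  have eAC : (a^2+b^2+c^2+d^2)*(a^2-b^2+c^2-d^2) - (a^2+b^2-c^2-d^2)*(a^2-b^2-c^2+d^2)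
      = 4*(a^2*c^2-b^2*d^2) := by ring
  have eBD : (a^2+b^2-c^2-d^2)*(a^2-b^2-c^2+d^2) - (a^2+b^2+c^2+d^2)*(a^2-b^2+c^2-d^2)
      = -(4*(a^2*c^2-b^2*d^2)) := by ring
  have eAD : (a^2+b^2+c^2+d^2)*(a^2-b^2-c^2+d^2) - (a^2+b^2-c^2-d^2)*(a^2-b^2+c^2-d^2)
      = 4*(a^2*d^2-b^2*c^2) := by ring
  have eBC : (a^2+b^2-c^2-d^2)*(a^2-b^2+c^2-d^2) - (a^2+b^2+c^2+d^2)*(a^2-b^2-c^2+d^2)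
      = -(4*(a^2*d^2-b^2*c^2)) := by ring
  have cancel : ∀ x y : K, y ≠ 0 → x * y / (4 * y) = x / 4 := fun x y hy =>
    mul_div_mul_right x 4 hy
  fin_cases i <;> fin_cases j <;>
    simp [BB, eAB, eCD, eAC, eBD, eAD, eBC, cancel, hA, hB, hC, hD] <;>
    field_simp <;> ring

/-- on the Fast Kummer surface, for `v0 = (a,b,c,d)` (the identity) and
any nonzero point `w` of the surface, the matrix `(B_{ij}(w,v0))` of biquadratic forms
is projectively equal to the matrix `(w_i * w_j)` (the case `Q = identity`). -/
theorem biquadratic_identity_at_identity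
    {K : Type*} [Field K] [IsAlgClosed K] (h2 : (2 : K) ≠ 0)
    (a b c d bigA bigB bigC bigD rho sig tau : K)
    (hA : bigA = a^2+b^2+c^2+d^2) (hB : bigB = a^2+b^2-c^2-d^2)
    (hC : bigC = a^2-b^2+c^2-d^2) (hD : bigD = a^2-b^2-c^2+d^2)
    (habcd : a*b*c*d*bigA*bigB*bigC*bigD ≠ 0)
    (hden : (a^2*d^2-b^2*c^2)*(a^2*c^2-b^2*d^2)*(a^2*b^2-c^2*d^2) ≠ 0)
    (hABCD : (bigA*bigB - bigC*bigD)*(bigA*bigC - bigB*bigD)*(bigA*bigD - bigB*bigC) ≠ 0)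
    (hn1 : a*c - b*d ≠ 0)
    (hrho : rho = bigC*bigD/(bigA*bigB))
    (hsig : sig = (a*c+b*d)*bigC/((a*c-b*d)*bigA))
    (htau : tau = (a*c+b*d)*bigD/((a*c-b*d)*bigB))
    (hdist : [(0 : K), 1, rho, sig, tau].Pairwise (· ≠ ·)) :
    ∀ w : Fin 4 → K, w ≠ 0 → KFast a b c d (w 0) (w 1) (w 2) (w 3) = 0 →
      ∀ i j k l : Fin 4,
        BB a b c d w ![a, b, c, d] i j * w k * w l
          = BB a b c d w ![a, b, c, d] k l * w i * w j := by
  subst hA hB hC hD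
  simp only [mul_ne_zero_iff] at habcd hden
  obtain ⟨⟨⟨⟨-, hA⟩, hB⟩, hC⟩, hD⟩ := habcd
  obtain ⟨⟨hAD, hAC⟩, hAB⟩ := hden
  intro w _ _ i j k l
  simp only [BB_at_identity h2 a b c d hA hB hC hD hAD hAC hAB w]
  ring

end
end
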